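/- Central limit theorem for the Bergman measures: fix ρ ∈ ℝ^m and set μ := ∇φ(ρ), H := Hess φ(ρ). Assume (i) hypothesis (QQ) on every compact subset of P°; (ii) the density-of-states expansion Π_k(ρ) = k^m(1 + O(1/k)); and (iii) localization at ρ: for every δ > 0, Π_k(ρ)^{-1} Σ_{α ∈ kP∩ℤ^m, |α/k − μ| ≥ δ} w_{k,α}(ρ) → 0 as k → ∞. Then the centered, √k-dilated measures D_{√k} μ̃_k^ρ (the push-forward of μ_k^ρ under x ↦ √k(x − μ)) converge weak* on C_b(ℝ^m) to the centered Gaussian measure γ_{0,H}: for every bounded continuous f : ℝ^m → ℝ, Π_k(ρ)^{-1} Σ_{α ∈ kP∩ℤ^m} w_{k,α}(ρ) f( √k(α/k − μ) ) → ∫_{ℝ^m} f(x) dγ_{0,H}(x). -/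

import Mathlib

open MeasureTheory Real Filter
open scoped BigOperators Topology Classical ENNReal

noncomputable section

/-- Euclidean dot product on `ℝ^m`. -/
def dotp {m : ℕ} (x y : Fin m → ℝ) : ℝ := ∑ i, x i * y i

/-- Euclidean norm on `ℝ^m`. -/
def enorm' {m : ℕ} (x : Fin m → ℝ) : ℝ := Real.sqrt (∑ i, x i ^ 2)

/-- Partial derivative `∂f/∂ρ_j`. -/
def pd {m : ℕ} (f : (Fin m → ℝ) → ℝ) (j : Fin m) (ρ : Fin m → ℝ) : ℝ :=
  fderiv ℝ f ρ (Pi.single j 1)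

/-- Hessian matrix `(∂²f/∂ρ_i∂ρ_j)`. -/
def hess {m : ℕ} (f : (Fin m → ℝ) → ℝ) (ρ : Fin m → ℝ) : Matrix (Fin m) (Fin m) ℝ :=
  Matrix.of fun i j => pd (fun ρ' => pd f j ρ') i ρ

/-- Gradient map `∇f : ℝ^m → ℝ^m`. -/
def gradMap {m : ℕ} (f : (Fin m → ℝ) → ℝ) (ρ : Fin m → ℝ) : Fin m → ℝ :=
  fun i => pd f i ρ

/-- The rescaled lattice point `α/k ∈ ℝ^m`. -/
def lpt {m : ℕ} (k : ℕ) (α : Fin m → ℤ) : Fin m → ℝ := fun i => (α i : ℝ) / k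

/-- The norming constant `Q_k(α) = ∫ e^{⟨α,ρ⟩ - kφ(ρ)} det(Hess φ(ρ)) dρ`. -/
def Qk {m : ℕ} (φ : (Fin m → ℝ) → ℝ) (k : ℕ) (α : Fin m → ℤ) : ℝ :=
  ∫ ρ : Fin m → ℝ, Real.exp (dotp (fun i => (α i : ℝ)) ρ - k * φ ρ) * (hess φ ρ).det

/-- The Bergman weight `w_{k,α}(ρ) = e^{⟨α,ρ⟩ - kφ(ρ)}/Q_k(α)` for `α ∈ kP ∩ ℤ^m`. -/
def wt {m : ℕ} (P : Set (Fin m → ℝ)) (φ : (Fin m → ℝ) → ℝ) (k : ℕ) (α : Fin m → ℤ)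
    (ρ : Fin m → ℝ) : ℝ :=
  if lpt k α ∈ P then Real.exp (dotp (fun i => (α i : ℝ)) ρ - k * φ ρ) / Qk φ k α else 0

/-- The Bergman density of states `Π_k(ρ) = Σ_{α ∈ kP∩ℤ^m} w_{k,α}(ρ)`. -/
def dos {m : ℕ} (P : Set (Fin m → ℝ)) (φ : (Fin m → ℝ) → ℝ) (k : ℕ) (ρ : Fin m → ℝ) : ℝ :=
  ∑' α : Fin m → ℤ, wt P φ k α ρ

/-- The inverse `ρ(·)` of the moment map `∇φ`. -/
def legInv {m : ℕ} (φ : (Fin m → ℝ) → ℝ) : (Fin m → ℝ) → (Fin m → ℝ) :=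
  Function.invFun (gradMap φ)

/-- The symplectic potential (Legendre transform) `u(x) = ⟨x, ρ(x)⟩ - φ(ρ(x))`. -/
def sympPot {m : ℕ} (φ : (Fin m → ℝ) → ℝ) (x : Fin m → ℝ) : ℝ :=
  dotp x (legInv φ x) - φ (legInv φ x)

/-- The centered Gaussian density with covariance matrix `S`:
`γ_{0,S}(v) = (2π)^{-m/2} (det S)^{-1/2} e^{-(1/2)⟨S⁻¹v, v⟩}`. -/
def gaussDen {m : ℕ} (S : Matrix (Fin m) (Fin m) ℝ) (v : Fin m → ℝ) : ℝ :=
  (2 * π) ^ (-(m : ℝ) / 2) * (Real.sqrt S.det)⁻¹ *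
    Real.exp (-(1 / 2) * dotp (S⁻¹.mulVec v) v)


open scoped MatrixOrder Matrix.Norms.L2Operator in
theorem integrable_and_integral_gaussDen {m : ℕ} (S : Matrix (Fin m) (Fin m) ℝ) (hS : S.PosDef) :
    Integrable (gaussDen S) ∧ ∫ x, gaussDen S x = 1 := by
  obtain ⟨B, hB⟩ : ∃ B : Matrix (Fin m) (Fin m) ℝ, S⁻¹ = B.transpose * B := by
    obtain ⟨B, -, hB⟩ := CStarAlgebra.isStrictlyPositive_iff_eq_star_mul_self.mp
      hS.inv.isStrictlyPositive
    exact ⟨B, by rw [hB, Matrix.star_eq_conjTranspose,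
      Matrix.conjTranspose_eq_transpose_of_trivial]⟩
  have hdet : B.det ^ 2 = S.det⁻¹ := by
    have h := congrArg Matrix.det hB
    rw [Matrix.det_mul, Matrix.det_transpose, Matrix.det_nonsing_inv, Ring.inverse_eq_inv] at h
    rw [h, sq]
  have hB0 : B.det ≠ 0 := by
    intro h
    rw [h, zero_pow two_ne_zero] at hdet
    exact (inv_pos.2 hS.det_pos).ne hdet
  set c : ℝ := (2 * π) ^ (-(m : ℝ) / 2) * (Real.sqrt S.det)⁻¹ with hc
  set g : (Fin m → ℝ) → ℝ := fun x => ∏ i, Real.exp (-(1 / 2) * x i ^ 2) with hg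
  have hden : gaussDen S = fun x => c * g (Matrix.toLin' B x) := by
    funext x
    have hq : dotp (S⁻¹.mulVec x) x = ∑ i, (B.mulVec x) i ^ 2 := by
      change (S⁻¹.mulVec x) ⬝ᵥ x = _
      rw [hB, ← Matrix.mulVec_mulVec, dotProduct_comm, Matrix.dotProduct_mulVec,
        Matrix.vecMul_transpose]
      simp [dotProduct, sq]
    simp only [gaussDen, hg, hc, Matrix.toLin'_apply, hq, ← Real.exp_sum, Finset.mul_sum]
  have hgi : Integrable g :=
    Integrable.fintype_prod (f := fun _ (t : ℝ) => Real.exp (-(1 / 2) * t ^ 2))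
      fun _ => integrable_exp_neg_mul_sq (by norm_num)
  have hgint : ∫ x, g x = √(2 * π) ^ m := by
    simp only [hg]
    rw [integral_fintype_prod_volume_eq_prod
      (fun (_ : Fin m) (t : ℝ) => Real.exp (-(1 / 2) * t ^ 2)), integral_gaussian,
      Finset.prod_const, Finset.card_univ, Fintype.card_fin]
    congr 2
    ring
  have hmap := Real.map_matrix_volume_pi_eq_smul_volume_pi hB0
  have hmeas : Measurable (Matrix.toLin' B) := (LinearMap.continuous_on_pi _).measurable
  have hgi' : Integrable g (Measure.map (Matrix.toLin' B) volume) := by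
    rw [hmap]; exact hgi.smul_measure ENNReal.ofReal_ne_top
  have hcomp : ∫ x, g (Matrix.toLin' B x) = |(B.det)⁻¹| * √(2 * π) ^ m := by
    rw [← integral_map hmeas.aemeasurable hgi'.aestronglyMeasurable, hmap, integral_smul_measure,
      hgint, ENNReal.toReal_ofReal (abs_nonneg _), smul_eq_mul]
  refine ⟨?_, ?_⟩
  · rw [hden]
    exact ((integrable_map_measure hgi'.aestronglyMeasurable hmeas.aemeasurable).1 hgi').const_mul c
  · rw [hden, integral_const_mul, hcomp, hc]
    have h1 : |(B.det)⁻¹| = √S.det := by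
      rw [← Real.sqrt_sq_eq_abs, inv_pow, hdet, inv_inv]
    have h2 : √(2 * π) ^ m = (2 * π) ^ ((m : ℝ) / 2) := by
      rw [Real.sqrt_eq_rpow, ← Real.rpow_natCast, ← Real.rpow_mul (by positivity)]
      congr 1; ring
    have h3 : (2 * π) ^ (-(m : ℝ) / 2) * (2 * π) ^ ((m : ℝ) / 2) = 1 := by
      rw [← Real.rpow_add (by positivity)]
      simp [neg_div]
    have h4 : √S.det ≠ 0 := (Real.sqrt_pos.2 hS.det_pos).ne'
    calc (2 * π) ^ (-(m : ℝ) / 2) * (√S.det)⁻¹ * (|(B.det)⁻¹| * √(2 * π) ^ m)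
        = ((2 * π) ^ (-(m : ℝ) / 2) * (2 * π) ^ ((m : ℝ) / 2)) * ((√S.det)⁻¹ * √S.det) := by
          rw [h1, h2]; ring
      _ = 1 := by rw [h3, inv_mul_cancel₀ h4, one_mul]

theorem gaussDen_nonneg {m : ℕ} (S : Matrix (Fin m) (Fin m) ℝ) (x : Fin m → ℝ) :
    0 ≤ gaussDen S x := by
  unfold gaussDen; positivity

/-- **Scheffé's lemma**. -/
theorem tendsto_integral_abs_sub_of_tendsto_integral {X : Type*} [MeasurableSpace X]
    {μ : Measure X} {h : ℕ → X → ℝ} {g : X → ℝ}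
    (hint : ∀ᶠ k in atTop, Integrable (h k) μ) (hnn : ∀ᶠ k in atTop, ∀ x, 0 ≤ h k x)
    (hg : Integrable g μ) (hgnn : ∀ x, 0 ≤ g x)
    (hlim : ∀ᵐ x ∂μ, Tendsto (fun k => h k x) atTop (𝓝 (g x)))
    (hmass : Tendsto (fun k => ∫ x, h k x ∂μ) atTop (𝓝 (∫ x, g x ∂μ))) :
    Tendsto (fun k => ∫ x, |h k x - g x| ∂μ) atTop (𝓝 0) := by
  have hpos : Tendsto (fun k => ∫ x, max (g x - h k x) 0 ∂μ) atTop (𝓝 (∫ _, (0 : ℝ) ∂μ)) := by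
    refine tendsto_integral_filter_of_dominated_convergence g ?_ ?_ hg ?_
    · filter_upwards [hint] with k hk
      exact ((hg.sub hk).pos_part).aestronglyMeasurable
    · filter_upwards [hnn] with k hk
      refine Eventually.of_forall fun x => ?_
      rw [Real.norm_of_nonneg (le_max_right _ _)]
      exact max_le (by linarith [hk x]) (hgnn x)
    · filter_upwards [hlim] with x hx
      have := (tendsto_const_nhds (x := g x)).sub hx
      simpa using this.max (tendsto_const_nhds (x := (0 : ℝ)))
  have hsum : Tendsto (fun k => (∫ x, h k x ∂μ - ∫ x, g x ∂μ)
      + 2 * ∫ x, max (g x - h k x) 0 ∂μ) atTop (𝓝 0) := by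
    have := (hmass.sub_const (∫ x, g x ∂μ)).add (hpos.const_mul 2)
    simpa using this
  refine hsum.congr' ?_
  filter_upwards [hint] with k hk
  have hk1 : Integrable (fun x => h k x - g x) μ := hk.sub hg
  have hk2 : Integrable (fun x => 2 * max (g x - h k x) 0) μ :=
    ((hg.sub hk).pos_part).const_mul 2
  rw [← integral_sub hk hg, ← integral_const_mul, ← integral_add hk1 hk2]
  refine integral_congr_ae (Eventually.of_forall fun x => ?_)
  simp only
  rcases le_total (h k x) (g x) with hle | hle
  · rw [max_eq_left (by linarith), abs_of_nonpos (by linarith)]; ring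
  · rw [max_eq_right (by linarith), abs_of_nonneg (by linarith)]; ring

/-- Along densities converging in `L¹`, integrals of uniformly bounded, pointwise convergent
functions converge. -/
theorem tendsto_integral_mul_of_tendsto_integral_abs_sub {X : Type*} [MeasurableSpace X]
    {μ : Measure X} {h F : ℕ → X → ℝ} {g f : X → ℝ} {B : ℝ}
    (hint : ∀ᶠ k in atTop, Integrable (h k) μ) (hg : Integrable g μ)
    (hL1 : Tendsto (fun k => ∫ x, |h k x - g x| ∂μ) atTop (𝓝 0))
    (hF : ∀ k, AEStronglyMeasurable (F k) μ) (hFB : ∀ k x, |F k x| ≤ B)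
    (hlim : ∀ᵐ x ∂μ, Tendsto (fun k => F k x) atTop (𝓝 (f x))) :
    Tendsto (fun k => ∫ x, h k x * F k x ∂μ) atTop (𝓝 (∫ x, f x * g x ∂μ)) := by
  have h1 : Tendsto (fun k => ∫ x, F k x * g x ∂μ) atTop (𝓝 (∫ x, f x * g x ∂μ)) := by
    refine tendsto_integral_of_dominated_convergence (fun x => B * |g x|)
      (fun k => (hF k).mul hg.aestronglyMeasurable) (hg.abs.const_mul B) ?_ ?_
    · intro k
      refine Eventually.of_forall fun x => ?_
      rw [Real.norm_eq_abs, abs_mul]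
      exact mul_le_mul_of_nonneg_right (hFB k x) (abs_nonneg _)
    · filter_upwards [hlim] with x hx
      exact hx.mul_const _
  have h2 : Tendsto (fun k => ∫ x, (h k x - g x) * F k x ∂μ) atTop (𝓝 0) := by
    refine squeeze_zero_norm' ?_ (by simpa using hL1.const_mul B)
    filter_upwards [hint] with k hk
    rw [← integral_const_mul]
    refine norm_integral_le_of_norm_le ((hk.sub hg).abs.const_mul B)
      (Eventually.of_forall fun x => ?_)
    rw [Real.norm_eq_abs, abs_mul, mul_comm]
    exact mul_le_mul_of_nonneg_right (hFB k x) (abs_nonneg _)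
  have h3 := h2.add h1
  rw [zero_add] at h3
  refine h3.congr' ?_
  filter_upwards [hint] with k hk
  rw [← integral_add]
  · refine integral_congr_ae (Eventually.of_forall fun x => ?_)
    simp only
    ring
  · exact (hk.sub hg).mul_bdd (c := B) (hF k) (Eventually.of_forall fun x => hFB k x)
  · exact hg.bdd_mul (c := B) (hF k) (Eventually.of_forall fun x => hFB k x)

theorem measurable_piFloor {m : ℕ} : Measurable fun (y : Fin m → ℝ) i => ⌊y i⌋ :=
  measurable_pi_lambda _ fun i => (measurable_pi_apply i).floor

theorem map_piFloor_volume {m : ℕ} :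
    Measure.map (fun (y : Fin m → ℝ) i => ⌊y i⌋) volume = Measure.count := by
  refine Measure.ext_of_singleton fun α => ?_
  rw [Measure.map_apply measurable_piFloor (measurableSet_singleton _), Measure.count_singleton]
  have : (fun (y : Fin m → ℝ) i => ⌊y i⌋) ⁻¹' {α} =
      Set.univ.pi fun i => Set.Ico (α i : ℝ) (α i + 1) := by
    ext y
    simp [funext_iff, Int.floor_eq_iff]
  rw [this, Real.volume_pi_Ico]
  simp

theorem integrable_and_integral_comp_piFloor {m : ℕ} (F : (Fin m → ℤ) → ℝ)
    (hF : F.support.Finite) {s : ℝ} (hs : 0 < s) (b : Fin m → ℝ) :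
    Integrable (fun y : Fin m → ℝ => F fun i => ⌊(s • y + b) i⌋) ∧
      ∫ y : Fin m → ℝ, F (fun i => ⌊(s • y + b) i⌋) = (s ^ m)⁻¹ * ∑' α, F α := by
  have hFm : Measurable F := measurable_of_countable F
  have hsum : Summable fun α => F α := summable_of_hasFiniteSupport hF
  have hFc : Integrable F Measure.count := by
    rw [integrable_count_iff]; exact hsum.norm
  have h0 : Integrable fun y : Fin m → ℝ => F fun i => ⌊y i⌋ := by
    rw [← map_piFloor_volume] at hFc
    exact (integrable_map_measure hFm.aestronglyMeasurable measurable_piFloor.aemeasurable).1 hFc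
  have h1 : ∫ y : Fin m → ℝ, F (fun i => ⌊y i⌋) = ∑' α, F α := by
    rw [← integral_map (f := F) measurable_piFloor.aemeasurable hFm.aestronglyMeasurable,
      map_piFloor_volume, integral_countable hFc]
    simp [Measure.real]
  refine ⟨(h0.comp_add_right b).comp_smul hs.ne', ?_⟩
  have h2 := Measure.integral_comp_smul volume (fun y : Fin m → ℝ => F fun i => ⌊(y + b) i⌋) s
  rw [h2, integral_add_right_eq_self (fun y : Fin m → ℝ => F fun i => ⌊y i⌋) b, h1]
  simp [abs_of_pos hs]

/-- The linear functional `v ↦ ⟨v, w⟩`. -/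
def dotpCLM {m : ℕ} (w : Fin m → ℝ) : (Fin m → ℝ) →L[ℝ] ℝ :=
  ∑ i, w i • ContinuousLinearMap.proj i

theorem dotpCLM_apply {m : ℕ} (w v : Fin m → ℝ) : dotpCLM w v = dotp v w := by
  simp [dotpCLM, dotp, mul_comm]

theorem dotp_comm {m : ℕ} (v w : Fin m → ℝ) : dotp v w = dotp w v :=
  dotProduct_comm v w

theorem norm_dotpCLM_le {m : ℕ} (w : Fin m → ℝ) : ‖dotpCLM w‖ ≤ m * ‖w‖ := by
  refine ContinuousLinearMap.opNorm_le_bound _ (by positivity) fun v => ?_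
  rw [dotpCLM_apply, dotp]
  calc ‖∑ i, v i * w i‖ ≤ ∑ i : Fin m, ‖v‖ * ‖w‖ := by
        refine norm_sum_le_of_le _ fun i _ => ?_
        rw [norm_mul]
        exact mul_le_mul (norm_le_pi_norm v i) (norm_le_pi_norm w i) (norm_nonneg _) (norm_nonneg _)
    _ = m * ‖w‖ * ‖v‖ := by simp; ring

theorem continuous_dotp {m : ℕ} : Continuous fun p : (Fin m → ℝ) × (Fin m → ℝ) => dotp p.1 p.2 := by
  unfold dotp; fun_prop

theorem HasFDerivAt.dotp {m : ℕ} {E : Type*} [NormedAddCommGroup E] [NormedSpace ℝ E]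
    {f g : E → Fin m → ℝ} {f' g' : E →L[ℝ] (Fin m → ℝ)} {x : E}
    (hf : HasFDerivAt f f' x) (hg : HasFDerivAt g g' x) :
    HasFDerivAt (fun z => dotp (f z) (g z))
      ((dotpCLM (f x)).comp g' + (dotpCLM (g x)).comp f') x := by
  have h := HasFDerivAt.fun_sum (u := Finset.univ) fun i _ =>
    (hasFDerivAt_pi'.1 hf i).mul (hasFDerivAt_pi'.1 hg i)
  refine h.congr_fderiv ?_
  ext v
  simp [dotpCLM_apply, _root_.dotp, Finset.sum_add_distrib, mul_comm]

/-- A function whose derivative is `o(x - a)` varies by `o(‖x - a‖²)` around `a`. -/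
theorem isLittleO_sub_sq_of_hasFDerivAt {E : Type*} [NormedAddCommGroup E] [NormedSpace ℝ E]
    {F : E → ℝ} {F' : E → E →L[ℝ] ℝ} {a : E} (h : ∀ᶠ x in 𝓝 a, HasFDerivAt F (F' x) x)
    (h' : F' =o[𝓝 a] fun x => x - a) :
    (fun x => F x - F a) =o[𝓝 a] fun x => ‖x - a‖ ^ 2 := by
  refine Asymptotics.IsLittleO.of_bound fun c hc => ?_
  obtain ⟨ε, hε, hball⟩ := Metric.eventually_nhds_iff_ball.1 (h.and (h'.bound hc))
  filter_upwards [Metric.ball_mem_nhds a hε] with x hx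
  have hsub : Metric.closedBall a ‖x - a‖ ⊆ Metric.ball a ε := by
    apply Metric.closedBall_subset_ball
    rwa [← dist_eq_norm]
  have := (convex_closedBall a ‖x - a‖).norm_image_sub_le_of_norm_hasFDerivWithin_le
    (f := F) (f' := F') (C := c * ‖x - a‖) (x := a) (y := x)
    (fun z hz => (hball z (hsub hz)).1.hasFDerivWithinAt)
    (fun z hz => (hball z (hsub hz)).2.trans (by
      rw [mem_closedBall_iff_norm] at hz; gcongr))
    (Metric.mem_closedBall_self (norm_nonneg _)) (by simp [dist_eq_norm])
  refine this.trans (le_of_eq ?_)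
  rw [norm_pow, norm_norm]; ring

section Legendre

theorem contDiff_pd {m : ℕ} {φ : (Fin m → ℝ) → ℝ} (hφ : ContDiff ℝ (⊤ : ℕ∞) φ) (j : Fin m) :
    ContDiff ℝ (⊤ : ℕ∞) (pd φ j) :=
  (hφ.fderiv_right (m := (⊤ : ℕ∞)) (by simp)).clm_apply contDiff_const

theorem contDiff_gradMap {m : ℕ} {φ : (Fin m → ℝ) → ℝ} (hφ : ContDiff ℝ (⊤ : ℕ∞) φ) :
    ContDiff ℝ (⊤ : ℕ∞) (gradMap φ) :=
  contDiff_pi.2 fun i => contDiff_pd hφ i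

theorem continuous_hess {m : ℕ} {φ : (Fin m → ℝ) → ℝ} (hφ : ContDiff ℝ (⊤ : ℕ∞) φ) :
    Continuous (hess φ) :=
  continuous_matrix fun i j => (contDiff_pd (contDiff_pd hφ j) i).continuous

theorem fderiv_apply_eq_dotp {m : ℕ} (f : (Fin m → ℝ) → ℝ) (r v : Fin m → ℝ) :
    fderiv ℝ f r v = dotp v (gradMap f r) := by
  conv_lhs => rw [pi_eq_sum_univ' v]
  simp [map_sum, dotp, gradMap, pd]

/-- Multiplication by a matrix, as a continuous linear map. -/
def mulVecCLM {m : ℕ} (A : Matrix (Fin m) (Fin m) ℝ) : (Fin m → ℝ) →L[ℝ] (Fin m → ℝ) :=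
  LinearMap.toContinuousLinearMap (Matrix.toLin' A)

theorem mulVecCLM_apply {m : ℕ} (A : Matrix (Fin m) (Fin m) ℝ) (v : Fin m → ℝ) :
    mulVecCLM A v = A.mulVec v := rfl

/-- Multiplication by an invertible matrix, as a continuous linear equivalence. -/
def mulVecCLE {m : ℕ} (A : Matrix (Fin m) (Fin m) ℝ) (hA : IsUnit A.det) :
    (Fin m → ℝ) ≃L[ℝ] (Fin m → ℝ) :=
  ContinuousLinearEquiv.equivOfInverse (mulVecCLM A) (mulVecCLM A⁻¹)
    (fun v => by simp [mulVecCLM_apply, Matrix.mulVec_mulVec, Matrix.nonsing_inv_mul _ hA])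
    (fun v => by simp [mulVecCLM_apply, Matrix.mulVec_mulVec, Matrix.mul_nonsing_inv _ hA])

theorem hess_symm {m : ℕ} {φ : (Fin m → ℝ) → ℝ} {r : Fin m → ℝ} (h : (hess φ r).PosDef)
    (i j : Fin m) : hess φ r i j = hess φ r j i := by
  simpa using h.isHermitian.apply j i

theorem hasStrictFDerivAt_gradMap {m : ℕ} {φ : (Fin m → ℝ) → ℝ} (hφ : ContDiff ℝ (⊤ : ℕ∞) φ)
    {r : Fin m → ℝ} (h : (hess φ r).PosDef) :
    HasStrictFDerivAt (gradMap φ) (mulVecCLM (hess φ r)) r := by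
  have h1 := ((contDiff_gradMap hφ).contDiffAt (x := r)).hasStrictFDerivAt (by simp)
  refine h1.congr_fderiv ?_
  symm
  ext1 v
  funext i
  have h2 : fderiv ℝ (gradMap φ) r v i = fderiv ℝ (pd φ i) r v := by
    have h3 := hasFDerivAt_pi'.1 h1.hasFDerivAt i
    rw [show fderiv ℝ (pd φ i) r = _ from h3.fderiv]
    rfl
  rw [h2, fderiv_apply_eq_dotp, mulVecCLM_apply, Matrix.mulVec, dotProduct_comm]
  refine Finset.sum_congr rfl fun j _ => ?_
  exact congrArg (v j * ·) (hess_symm h i j)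

variable {m : ℕ} {φ : (Fin m → ℝ) → ℝ}

theorem legInv_gradMap (hinj : Function.Injective (gradMap φ)) (r : Fin m → ℝ) :
    legInv φ (gradMap φ r) = r :=
  Function.leftInverse_invFun hinj r

theorem hasStrictFDerivAt_legInv (hφ : ContDiff ℝ (⊤ : ℕ∞) φ)
    (hinj : Function.Injective (gradMap φ)) {r : Fin m → ℝ} (h : (hess φ r).PosDef) :
    HasStrictFDerivAt (legInv φ) (mulVecCLM (hess φ r)⁻¹) (gradMap φ r) :=
  HasStrictFDerivAt.to_local_left_inverse (f' := mulVecCLE (hess φ r) h.det_pos.ne'.isUnit)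
    (hasStrictFDerivAt_gradMap hφ h) (Eventually.of_forall (legInv_gradMap hinj))

theorem range_gradMap_mem_nhds (hφ : ContDiff ℝ (⊤ : ℕ∞) φ) {r : Fin m → ℝ}
    (h : (hess φ r).PosDef) : Set.range (gradMap φ) ∈ 𝓝 (gradMap φ r) := by
  rw [← HasStrictFDerivAt.map_nhds_eq_of_equiv
    (f' := mulVecCLE (hess φ r) h.det_pos.ne'.isUnit) (hasStrictFDerivAt_gradMap hφ h)]
  exact range_mem_map

theorem hasFDerivAt_sympPot (hφ : ContDiff ℝ (⊤ : ℕ∞) φ)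
    (hinj : Function.Injective (gradMap φ)) {r : Fin m → ℝ} (h : (hess φ r).PosDef) :
    HasFDerivAt (sympPot φ) (dotpCLM r) (gradMap φ r) := by
  have h1 := (hasStrictFDerivAt_legInv hφ hinj h).hasFDerivAt
  have h2 : HasFDerivAt φ (fderiv ℝ φ r) (legInv φ (gradMap φ r)) := by
    rw [legInv_gradMap hinj]
    exact (hφ.differentiable (by simp) r).hasFDerivAt
  refine (((hasFDerivAt_id _).dotp h1).sub (h2.comp _ h1)).congr_fderiv ?_
  ext1 v
  simp [dotpCLM_apply, fderiv_apply_eq_dotp, legInv_gradMap hinj]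

theorem det_hess_sympPot (hφ : ContDiff ℝ (⊤ : ℕ∞) φ)
    (hpos : ∀ r, (hess φ r).PosDef) (hinj : Function.Injective (gradMap φ)) (r : Fin m → ℝ) :
    (hess (sympPot φ) (gradMap φ r)).det = ((hess φ r).det)⁻¹ := by
  have h1 := (hasStrictFDerivAt_legInv hφ hinj (hpos r)).hasFDerivAt
  have h2 : hess (sympPot φ) (gradMap φ r) = ((hess φ r)⁻¹).transpose := by
    ext i j
    have h3 : pd (sympPot φ) j =ᶠ[𝓝 (gradMap φ r)] fun x => legInv φ x j := by
      filter_upwards [range_gradMap_mem_nhds hφ (hpos r)]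
      rintro _ ⟨z, rfl⟩
      rw [pd, (hasFDerivAt_sympPot hφ hinj (hpos z)).fderiv, legInv_gradMap hinj, dotpCLM_apply]
      simp [dotp, Pi.single_apply]
    change fderiv ℝ (pd (sympPot φ) j) (gradMap φ r) (Pi.single i 1) = _
    rw [h3.fderiv_eq, (hasFDerivAt_pi'.1 h1 j).fderiv]
    simp [mulVecCLM_apply]
  rw [h2, Matrix.det_transpose, Matrix.det_nonsing_inv, Ring.inverse_eq_inv]

/-- Second order Taylor expansion of the symplectic potential at `∇φ(r)`. -/
theorem sympPot_taylor_isLittleO (hφ : ContDiff ℝ (⊤ : ℕ∞) φ)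
    (hpos : ∀ r, (hess φ r).PosDef) (hinj : Function.Injective (gradMap φ)) (r : Fin m → ℝ) :
    (fun x => sympPot φ x - dotp x r + φ r -
      1 / 2 * dotp ((hess φ r)⁻¹.mulVec (x - gradMap φ r)) (x - gradMap φ r))
      =o[𝓝 (gradMap φ r)] fun x => ‖x - gradMap φ r‖ ^ 2 := by
  set μ := gradMap φ r with hμ
  set A := (hess φ r)⁻¹ with hA
  have hAs : A.transpose = A := by
    rw [← Matrix.conjTranspose_eq_transpose_of_trivial]
    exact (hpos r).inv.isHermitian
  have hsymm : ∀ v w, dotp (A.mulVec v) w = dotp (A.mulVec w) v := fun v w => by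
    change A.mulVec v ⬝ᵥ w = A.mulVec w ⬝ᵥ v
    rw [dotProduct_comm, Matrix.dotProduct_mulVec, ← Matrix.mulVec_transpose, hAs]
  have hder : ∀ᶠ x in 𝓝 μ, HasFDerivAt (fun x => sympPot φ x - dotp x r + φ r -
      1 / 2 * dotp (A.mulVec (x - μ)) (x - μ))
      (dotpCLM (legInv φ x - legInv φ μ - mulVecCLM A (x - μ))) x := by
    filter_upwards [range_gradMap_mem_nhds hφ (hpos r)]
    rintro _ ⟨z, rfl⟩
    have e1 := hasFDerivAt_sympPot hφ hinj (hpos z)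
    have e2 := (hasFDerivAt_id (𝕜 := ℝ) (gradMap φ z)).dotp (hasFDerivAt_const r (gradMap φ z))
    have e3 : HasFDerivAt (fun x : Fin m → ℝ => x - μ) (ContinuousLinearMap.id ℝ _)
        (gradMap φ z) := (hasFDerivAt_id _).sub_const μ
    have e4 := ((mulVecCLM A).hasFDerivAt.comp (gradMap φ z) e3).dotp e3
    refine (((e1.sub e2).add_const (φ r)).sub (e4.const_mul (1 / 2))).congr_fderiv ?_
    ext1 v
    have e5 := hsymm (gradMap φ z - μ) v
    simp [dotpCLM_apply, legInv_gradMap hinj, hμ, mulVecCLM_apply] at e5 ⊢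
    rw [e5.symm.trans (dotp_comm _ _)]
    simp only [dotp, Pi.sub_apply, mul_sub, Finset.sum_sub_distrib]
    ring
  have hlo : (fun x => dotpCLM (legInv φ x - legInv φ μ - mulVecCLM A (x - μ)))
      =o[𝓝 μ] fun x => x - μ := by
    refine Asymptotics.IsBigO.trans_isLittleO ?_
      (hasStrictFDerivAt_legInv hφ hinj (hpos r)).hasFDerivAt.isLittleO
    exact Asymptotics.IsBigO.of_bound m (Eventually.of_forall fun x => norm_dotpCLM_le _)
  refine (isLittleO_sub_sq_of_hasFDerivAt hder hlo).congr_left fun x => ?_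
  have h0 : sympPot φ μ - dotp μ r + φ r = 0 := by
    simp [sympPot, hμ, legInv_gradMap hinj]
  rw [h0]
  simp [dotp]

end Legendre

theorem finite_setOf_lpt_mem {m : ℕ} {P : Set (Fin m → ℝ)} (hP : IsCompact P) {k : ℕ}
    (hk : 1 ≤ k) : {α : Fin m → ℤ | lpt k α ∈ P}.Finite := by
  obtain ⟨R, hR⟩ := hP.isBounded.exists_norm_le
  have hk0 : (0 : ℝ) < k := by exact_mod_cast hk
  refine (Set.finite_Icc (fun _ => -⌈R * k⌉) (fun _ => ⌈R * k⌉)).subset fun α hα => ?_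
  have h : ∀ i, |(α i : ℝ)| ≤ ⌈R * k⌉ := fun i => by
    have h1 := (norm_le_pi_norm (lpt k α) i).trans (hR _ hα)
    rw [lpt, norm_div, Real.norm_natCast, div_le_iff₀ hk0] at h1
    exact h1.trans (Int.le_ceil _)
  refine ⟨fun i => ?_, fun i => ?_⟩
  · exact_mod_cast (abs_le.1 (h i)).1
  · exact_mod_cast (abs_le.1 (h i)).2

theorem finite_support_wt {m : ℕ} {P : Set (Fin m → ℝ)} (hP : IsCompact P)
    (φ : (Fin m → ℝ) → ℝ) {k : ℕ} (hk : 1 ≤ k) (ρ : Fin m → ℝ) :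
    (Function.support fun α => wt P φ k α ρ).Finite := by
  refine (finite_setOf_lpt_mem hP hk).subset fun α hα => ?_
  by_contra h
  exact hα (if_neg h)

theorem wt_nonneg {m : ℕ} (P : Set (Fin m → ℝ)) {φ : (Fin m → ℝ) → ℝ}
    (hpos : ∀ r, (hess φ r).PosDef) (k : ℕ) (α : Fin m → ℤ) (ρ : Fin m → ℝ) :
    0 ≤ wt P φ k α ρ := by
  unfold wt Qk
  split_ifs
  · exact div_nonneg (Real.exp_pos _).le
      (integral_nonneg fun r => mul_nonneg (Real.exp_pos _).le (hpos r).det_pos.le)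
  · exact le_rfl

/-- Local limit theorem: the rescaled Bergman weights converge to the Gaussian density. -/
theorem tendsto_rescaled_wt {m : ℕ} {P : Set (Fin m → ℝ)} {φ : (Fin m → ℝ) → ℝ}
    (hφ : ContDiff ℝ (⊤ : ℕ∞) φ) (hpos : ∀ r, (hess φ r).PosDef)
    (hφbij : Set.BijOn (gradMap φ) Set.univ (interior P)) (ρ : Fin m → ℝ)
    (hQQ : ∀ K : Set (Fin m → ℝ), IsCompact K → K ⊆ interior P →
      ∃ C > 0, ∀ k : ℕ, 1 ≤ k → ∀ α : Fin m → ℤ, lpt k α ∈ K →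
        |Qk φ k α * (k : ℝ) ^ ((m : ℝ) / 2) * (2 * π) ^ (-(m : ℝ) / 2)
            * Real.sqrt ((hess (sympPot φ) (lpt k α)).det)
            * Real.exp (-(k * sympPot φ (lpt k α))) - 1| ≤ C / k)
    {α : ℕ → Fin m → ℤ} {y : Fin m → ℝ}
    (hα : Tendsto (fun k : ℕ => √(k : ℝ) • (lpt k (α k) - gradMap φ ρ)) atTop (𝓝 y)) :
    Tendsto (fun k : ℕ => (√(k : ℝ) ^ m)⁻¹ * wt P φ k (α k) ρ) atTop
      (𝓝 (gaussDen (hess φ ρ) y)) := by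
  have hinj : Function.Injective (gradMap φ) := Set.injOn_univ.1 hφbij.injOn
  set μ := gradMap φ ρ with hμ
  set x : ℕ → Fin m → ℝ := fun k => lpt k (α k) with hx
  have hk1 : ∀ᶠ k : ℕ in atTop, 1 ≤ k := eventually_ge_atTop 1
  have hsqrt : Tendsto (fun k : ℕ => √(k : ℝ)) atTop atTop :=
    Real.tendsto_sqrt_atTop.comp tendsto_natCast_atTop_atTop
  have hxμ : Tendsto x atTop (𝓝 μ) := by
    have h := ((tendsto_inv_atTop_zero.comp hsqrt).smul hα).add_const μ
    rw [zero_smul, zero_add] at h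
    refine h.congr' ?_
    filter_upwards [hk1] with k hk
    have : √(k : ℝ) ≠ 0 := (Real.sqrt_pos.2 (by exact_mod_cast hk)).ne'
    simp [smul_smul, this, hx]
  obtain ⟨ε, hε, hεP⟩ := Metric.nhds_basis_closedBall.mem_iff.1
    (isOpen_interior.mem_nhds (hφbij.mapsTo (Set.mem_univ ρ)))
  have hxK : ∀ᶠ k in atTop, x k ∈ Metric.closedBall μ ε :=
    hxμ (Metric.closedBall_mem_nhds μ hε)
  set D : ℕ → ℝ := fun k => (hess (sympPot φ) (x k)).det with hD
  set A : ℕ → ℝ := fun k => Qk φ k (α k) * (k : ℝ) ^ ((m : ℝ) / 2) * (2 * π) ^ (-(m : ℝ) / 2)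
    * √(D k) * Real.exp (-(k * sympPot φ (x k))) with hA
  have hAlim : Tendsto A atTop (𝓝 1) := by
    obtain ⟨C, -, hC⟩ := hQQ _ (isCompact_closedBall μ ε) hεP
    rw [tendsto_iff_norm_sub_tendsto_zero]
    refine squeeze_zero' (Eventually.of_forall fun _ => norm_nonneg _) ?_
      (tendsto_const_div_atTop_nhds_zero_nat C)
    filter_upwards [hk1, hxK] with k hk hxk
    exact hC k hk (α k) hxk
  have hDlim : Tendsto D atTop (𝓝 ((hess φ ρ).det)⁻¹) := by
    have hcont : ContinuousAt (legInv φ) μ :=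
      (hasStrictFDerivAt_legInv hφ hinj (hpos ρ)).hasFDerivAt.continuousAt
    have h1 : Tendsto (fun k => (hess φ (legInv φ (x k))).det) atTop (𝓝 (hess φ ρ).det) := by
      have h2 := (hcont.tendsto.comp hxμ)
      rw [legInv_gradMap hinj] at h2
      exact ((continuous_hess hφ).matrix_det.tendsto ρ).comp h2
    refine (h1.inv₀ (hpos ρ).det_pos.ne').congr' ?_
    filter_upwards [hxμ (range_gradMap_mem_nhds hφ (hpos ρ))] with k hk
    obtain ⟨z, hz⟩ := hk
    simp only [hD]
    rw [← hz, det_hess_sympPot hφ hpos hinj, legInv_gradMap hinj]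
  set T : ℕ → ℝ := fun k => k * (sympPot φ (x k) - dotp (x k) ρ + φ ρ) with hT
  have hTlim : Tendsto T atTop (𝓝 (1 / 2 * dotp ((hess φ ρ)⁻¹.mulVec y) y)) := by
    have hq : Continuous fun v : Fin m → ℝ => 1 / 2 * dotp ((hess φ ρ)⁻¹.mulVec v) v :=
      continuous_const.mul (continuous_dotp.comp
        (((mulVecCLM (hess φ ρ)⁻¹).continuous).prodMk continuous_id))
    have h1 := (hq.tendsto y).comp hα
    have h2 : Tendsto (fun k => k * (sympPot φ (x k) - dotp (x k) ρ + φ ρ -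
        1 / 2 * dotp ((hess φ ρ)⁻¹.mulVec (x k - μ)) (x k - μ))) atTop (𝓝 0) := by
      have h3 := (Asymptotics.isBigO_refl (fun k : ℕ => (k : ℝ)) atTop).mul_isLittleO
        ((sympPot_taylor_isLittleO hφ hpos hinj ρ).comp_tendsto hxμ)
      refine (h3.trans_isBigO ?_).tendsto_zero_of_tendsto (hα.norm.pow 2)
      refine Asymptotics.isBigO_of_le _ fun k => le_of_eq ?_
      rw [norm_smul, mul_pow, Real.norm_of_nonneg (Real.sqrt_nonneg _),
        Real.sq_sqrt (Nat.cast_nonneg k)]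
      rfl
    have h3 := h2.add h1
    rw [zero_add] at h3
    refine h3.congr fun k => ?_
    have h4 : (k : ℝ) = √k * √k := (Real.mul_self_sqrt (Nat.cast_nonneg k)).symm
    simp only [hT, Function.comp_apply, Matrix.mulVec_smul]
    change _ + 1 / 2 * ((√(k : ℝ) • _) ⬝ᵥ (√(k : ℝ) • _)) = _
    rw [smul_dotProduct, dotProduct_smul, smul_eq_mul, smul_eq_mul, ← mul_assoc (√(k : ℝ)), ← h4]
    change _ + 1 / 2 * (k * dotp _ _) = _
    ring
  have hfin : Tendsto (fun k => (2 * π) ^ (-(m : ℝ) / 2) * √(D k) * Real.exp (-T k) / A k) atTop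
      (𝓝 (gaussDen (hess φ ρ) y)) := by
    have h := (((hDlim.sqrt.const_mul ((2 * π) ^ (-(m : ℝ) / 2))).mul
      ((Real.continuous_exp.tendsto _).comp hTlim.neg)).div hAlim one_ne_zero)
    rw [div_one, Real.sqrt_inv, ← neg_mul] at h
    exact h
  refine hfin.congr' ?_
  filter_upwards [hk1, hxK, hAlim.eventually_ne one_ne_zero] with k hk hxk hAk
  have hk0 : (0 : ℝ) < k := by exact_mod_cast hk
  have hxP : lpt k (α k) ∈ P := interior_subset (hεP hxk)
  rw [wt, if_pos hxP]
  have hpow : (k : ℝ) ^ ((m : ℝ) / 2) = √(k : ℝ) ^ m := by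
    rw [Real.sqrt_eq_rpow, ← Real.rpow_natCast, ← Real.rpow_mul hk0.le]
    congr 1; ring
  have hexp : Real.exp (-T k) = Real.exp (-(k * sympPot φ (x k))) *
      Real.exp (dotp (fun i => (α k i : ℝ)) ρ - k * φ ρ) := by
    have hdot : dotp (fun i => (α k i : ℝ)) ρ = k * dotp (x k) ρ := by
      simp only [dotp, hx, lpt, Finset.mul_sum]
      refine Finset.sum_congr rfl fun i _ => ?_
      field_simp
    rw [← Real.exp_add, hdot]
    congr 1
    simp only [hT]
    ring
  have hs : √(k : ℝ) ^ m ≠ 0 := pow_ne_zero _ (Real.sqrt_pos.2 hk0).ne'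
  have hA' : A k = Qk φ k (α k) * √(k : ℝ) ^ m * (2 * π) ^ (-(m : ℝ) / 2)
    * √(D k) * Real.exp (-(k * sympPot φ (x k))) := by simp only [hA, hpow]
  rw [hA'] at hAk ⊢
  rw [hexp]
  simp only [ne_eq, mul_eq_zero, not_or] at hAk
  obtain ⟨⟨⟨⟨hQ, -⟩, hp⟩, hd⟩, he⟩ := hAk
  field_simp

/-- central limit theorem for the Bergman measures: the centered,
`√k`-dilated measures converge weak* on `C_b(ℝ^m)` to the centered Gaussian with
covariance `Hess φ(ρ)`. -/
theorem central_limit_theorem {m : ℕ}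
    (P : Set (Fin m → ℝ)) (hPcpt : IsCompact P) (hPconv : Convex ℝ P)
    (hPint : (interior P).Nonempty)
    (φ : (Fin m → ℝ) → ℝ) (hφ : ContDiff ℝ (⊤ : ℕ∞) φ)
    (hφpos : ∀ ρ : Fin m → ℝ, (hess φ ρ).PosDef)
    (hφbij : Set.BijOn (gradMap φ) Set.univ (interior P))
    (ρ : Fin m → ℝ)
    (hQQ : ∀ K : Set (Fin m → ℝ), IsCompact K → K ⊆ interior P →
      ∃ C > 0, ∀ k : ℕ, 1 ≤ k → ∀ α : Fin m → ℤ, lpt k α ∈ K →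
        |Qk φ k α * (k : ℝ) ^ ((m : ℝ) / 2) * (2 * π) ^ (-(m : ℝ) / 2)
            * Real.sqrt ((hess (sympPot φ) (lpt k α)).det)
            * Real.exp (-(k * sympPot φ (lpt k α))) - 1| ≤ C / k)
    (hdos : ∃ C > 0, ∀ k : ℕ, 1 ≤ k → |dos P φ k ρ * ((k : ℝ) ^ m)⁻¹ - 1| ≤ C / k)
    (hloc : ∀ δ > 0,
      Tendsto (fun k : ℕ => (dos P φ k ρ)⁻¹ *
          ∑' α : Fin m → ℤ,
            if δ ≤ enorm' (lpt k α - gradMap φ ρ) then wt P φ k α ρ else 0)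
        atTop (𝓝 0)) :
    ∀ f : (Fin m → ℝ) → ℝ, Continuous f → (∃ B, ∀ x, |f x| ≤ B) →
      Tendsto (fun k : ℕ =>
          (dos P φ k ρ)⁻¹ *
            ∑' α : Fin m → ℤ, wt P φ k α ρ * f (Real.sqrt k • (lpt k α - gradMap φ ρ)))
        atTop
        (𝓝 (∫ x : Fin m → ℝ, f x * gaussDen (hess φ ρ) x)) := by
  intro f hf ⟨B, hB⟩
  set μ := gradMap φ ρ with hμ
  set a : ℕ → (Fin m → ℝ) → Fin m → ℤ :=
    fun k y i => ⌊(√(k : ℝ) • y + (k : ℝ) • μ) i⌋ with ha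
  set h : ℕ → (Fin m → ℝ) → ℝ := fun k y => (√(k : ℝ) ^ m)⁻¹ * wt P φ k (a k y) ρ with hh
  set F : ℕ → (Fin m → ℝ) → ℝ := fun k y => f (√(k : ℝ) • (lpt k (a k y) - μ)) with hF
  have hk1 : ∀ᶠ k : ℕ in atTop, 1 ≤ k := eventually_ge_atTop 1
  have hsqrt0 : ∀ k : ℕ, 1 ≤ k → 0 < √(k : ℝ) := fun k hk =>
    Real.sqrt_pos.2 (by exact_mod_cast hk)
  have hround : ∀ y, Tendsto (fun k : ℕ => √(k : ℝ) • (lpt k (a k y) - μ)) atTop (𝓝 y) := by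
    intro y
    have hsqrt : Tendsto (fun k : ℕ => (√(k : ℝ))⁻¹) atTop (𝓝 0) :=
      tendsto_inv_atTop_zero.comp (Real.tendsto_sqrt_atTop.comp tendsto_natCast_atTop_atTop)
    refine tendsto_pi_nhds.2 fun i => ?_
    rw [tendsto_iff_norm_sub_tendsto_zero]
    refine squeeze_zero' (Eventually.of_forall fun _ => norm_nonneg _) ?_ hsqrt
    filter_upwards [hk1] with k hk
    have hs := hsqrt0 k hk
    have hsq : (k : ℝ) = √k * √k := (Real.mul_self_sqrt (Nat.cast_nonneg k)).symm
    set t : ℝ := √(k : ℝ) * y i + k * μ i with ht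
    have e : (√(k : ℝ) • (lpt k (a k y) - μ)) i - y i = (√(k : ℝ))⁻¹ * (⌊t⌋ - t) := by
      simp only [ha, lpt, Pi.smul_apply, Pi.sub_apply, Pi.add_apply, smul_eq_mul, ← ht]
      generalize (⌊t⌋ : ℝ) = n
      rw [ht]
      generalize √(k : ℝ) = s at hs hsq ⊢
      rw [hsq]
      field_simp
      ring
    rw [e, norm_mul, Real.norm_of_nonneg (inv_nonneg.2 hs.le)]
    refine mul_le_of_le_one_right (inv_nonneg.2 hs.le) ?_
    rw [Real.norm_eq_abs, abs_le]
    constructor <;> linarith [Int.floor_le t, Int.lt_floor_add_one t]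
  have hpow : ∀ k : ℕ, (√(k : ℝ) ^ m)⁻¹ * (√(k : ℝ) ^ m)⁻¹ = ((k : ℝ) ^ m)⁻¹ := fun k => by
    rw [← mul_inv, ← mul_pow, Real.mul_self_sqrt (Nat.cast_nonneg k)]
  have key : ∀ k : ℕ, 1 ≤ k → ∀ G : (Fin m → ℤ) → ℝ,
      Integrable (fun y => h k y * G (a k y)) ∧
      ∫ y, h k y * G (a k y) = ((k : ℝ) ^ m)⁻¹ * ∑' α, wt P φ k α ρ * G α := by
    intro k hk G
    have hfin : (Function.support fun α => wt P φ k α ρ * G α).Finite :=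
      (finite_support_wt hPcpt φ hk ρ).subset fun α hα => left_ne_zero_of_mul hα
    obtain ⟨i1, i2⟩ := integrable_and_integral_comp_piFloor _ hfin (hsqrt0 k hk) ((k : ℝ) • μ)
    have e : (fun y => h k y * G (a k y)) =
        fun y => (√(k : ℝ) ^ m)⁻¹ * (wt P φ k (a k y) ρ * G (a k y)) :=
      funext fun y => mul_assoc _ _ _
    rw [e, integral_const_mul, i2, ← mul_assoc, hpow]
    exact ⟨i1.const_mul _, rfl⟩
  have hint : ∀ᶠ k in atTop, Integrable (h k) := by
    filter_upwards [hk1] with k hk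
    simpa using (key k hk fun _ => 1).1
  have hdoslim : Tendsto (fun k : ℕ => dos P φ k ρ * ((k : ℝ) ^ m)⁻¹) atTop (𝓝 1) := by
    obtain ⟨C, -, hC⟩ := hdos
    rw [tendsto_iff_norm_sub_tendsto_zero]
    refine squeeze_zero' (Eventually.of_forall fun _ => norm_nonneg _) ?_
      (tendsto_const_div_atTop_nhds_zero_nat C)
    filter_upwards [hk1] with k hk
    exact hC k hk
  obtain ⟨hgint, hg1⟩ := integrable_and_integral_gaussDen (hess φ ρ) (hφpos ρ)
  have hmass : Tendsto (fun k => ∫ y, h k y) atTop (𝓝 (∫ y, gaussDen (hess φ ρ) y)) := by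
    rw [hg1]
    refine hdoslim.congr' ?_
    filter_upwards [hk1] with k hk
    have := (key k hk fun _ => 1).2
    simp only [mul_one] at this
    rw [this, dos, mul_comm]
  have hL1 := tendsto_integral_abs_sub_of_tendsto_integral hint
    (Eventually.of_forall fun k y =>
      mul_nonneg (by positivity) (wt_nonneg P hφpos k (a k y) ρ))
    hgint (gaussDen_nonneg _)
    (Eventually.of_forall fun y => tendsto_rescaled_wt hφ hφpos hφbij ρ hQQ (hround y)) hmass
  have hFmeas : ∀ k, AEStronglyMeasurable (F k) := fun k =>
    ((measurable_of_countable fun α => f (√(k : ℝ) • (lpt k α - μ))).comp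
      (measurable_piFloor.comp
        ((measurable_id.const_smul (√(k : ℝ))).add_const ((k : ℝ) • μ)))).aestronglyMeasurable
  have hlim := tendsto_integral_mul_of_tendsto_integral_abs_sub hint hgint hL1 hFmeas
    (fun k y => hB _) (Eventually.of_forall fun y => (hf.tendsto y).comp (hround y))
  have hres := (hdoslim.inv₀ one_ne_zero).mul hlim
  rw [inv_one, one_mul] at hres
  refine hres.congr' ?_
  filter_upwards [hk1] with k hk
  have hkm : (k : ℝ) ^ m ≠ 0 := pow_ne_zero _ (by positivity)
  rw [(key k hk fun α => f (√(k : ℝ) • (lpt k α - μ))).2, mul_inv, inv_inv, mul_assoc,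
    mul_inv_cancel_left₀ hkm]
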